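/- Let Γ be a finitely generated non-amenable group with finite symmetric generating multi-set S, and let λ < 1 be the spectral radius of the Cayley graph Cay(Γ,S). For the generating multi-set S^{[k]} of words of length k in S, the spectral radius of Cay(Γ,S^{[k]}) is λ^k; consequently the expected FMSF degree satisfies δ_FMSF(Γ,S^{[k]}) ≥ 1/(4λ^k) − 1/4, which tends to infinity as k → ∞. -/

import Mathlib

open MeasureTheory Filter

/-- A multigraph given by oriented edges: each oriented edge `e` has a `tail`, a `head`
and an opposite edge `op e ≠ e`. -/
structure Multigraph where
  V : Type
  E : Type
  tail : E → V
  head : E → V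
  op : E → E
  op_op : ∀ e, op (op e) = e
  op_ne : ∀ e, op e ≠ e
  tail_op : ∀ e, tail (op e) = head e
  head_op : ∀ e, head (op e) = tail e

namespace Multigraph

variable (G : Multigraph)

/-- `n` consecutive oriented edges: the head of each edge is the tail of the next one. -/
def IsWalk (n : ℕ) (c : Fin n → G.E) : Prop :=
  ∀ i : Fin n, ∀ h : (i : ℕ) + 1 < n, G.head (c i) = G.tail (c ⟨(i : ℕ) + 1, h⟩)

/-- A path of length `n` from `x` to `y`. -/
def IsWalkFromTo (n : ℕ) (c : Fin n → G.E) (x y : G.V) : Prop :=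
  G.IsWalk n c ∧
    (∀ h : 0 < n, G.tail (c ⟨0, h⟩) = x ∧ G.head (c ⟨n - 1, by omega⟩) = y) ∧
    (n = 0 → x = y)

/-- `c(n,x,y)`: the number of paths of length `n` from `x` to `y`. -/
noncomputable def pathCount (n : ℕ) (x y : G.V) : ℕ :=
  Nat.card {c : Fin n → G.E // G.IsWalkFromTo n c x y}

/-- Vertex transitivity: any vertex can be mapped to any other by a graph automorphism. -/
def VertexTransitive : Prop :=
  ∀ x y : G.V, ∃ (φV : G.V ≃ G.V) (φE : G.E ≃ G.E),
    (∀ e, G.tail (φE e) = φV (G.tail e)) ∧ (∀ e, G.head (φE e) = φV (G.head e)) ∧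
    (∀ e, G.op (φE e) = φE (G.op e)) ∧ φV x = y

/-- Connectivity: any two vertices are joined by a sequence of edges. -/
def Connected : Prop :=
  ∀ x y : G.V, Relation.ReflTransGen (fun u v => ∃ e, G.tail e = u ∧ G.head e = v) x y

/-- Each vertex has degree `d`, i.e. exactly `d` oriented edges emanate from it. -/
def Degree (d : ℕ) : Prop := ∀ x : G.V, Nat.card {e : G.E // G.tail e = x} = d

/-- The spectral radius `(1/d)·limsup_n c(n)^{1/n}`, where `c(n)` is the number of cycles
of length `n` rooted at the base vertex `x₀`. -/
noncomputable def spectralRadius (d : ℕ) (x₀ : G.V) : ℝ :=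
  (1 / (d : ℝ)) * limsup (fun n : ℕ => (G.pathCount n x₀ x₀ : ℝ) ^ ((n : ℝ)⁻¹)) atTop

/-- Unordered edges: oriented edges modulo the orientation reversal `op`. -/
def UEdge : Type := Quot (fun e f : G.E => f = G.op e)

/-- The unordered edge underlying an oriented edge. -/
def uedge (e : G.E) : G.UEdge := Quot.mk _ e

/-- A simple cycle of length `n ≥ 1` rooted at `x`: a closed path from `x` to `x` in which
no vertex is visited twice and which is not a backtracking pair `(e, op e)`. -/
def IsSimpleCycle (n : ℕ) (c : Fin n → G.E) (x : G.V) : Prop :=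
  1 ≤ n ∧ G.IsWalkFromTo n c x x ∧
    Function.Injective (fun i : Fin n => G.tail (c i)) ∧
    ∀ h : n = 2, c ⟨1, by omega⟩ ≠ G.op (c ⟨0, by omega⟩)

/-- In the labelling `lbl`, the edge `e` is cut: it belongs to some simple cycle on which
its label is maximal. -/
def IsCut (lbl : G.UEdge → ℝ) (e : G.E) : Prop :=
  ∃ (n : ℕ) (x : G.V) (c : Fin n → G.E), G.IsSimpleCycle n c x ∧
    ∃ i : Fin n, (c i = e ∨ c i = G.op e) ∧
      ∀ j : Fin n, lbl (G.uedge (c j)) ≤ lbl (G.uedge (c i))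

/-- The edge `e` survives the cutting procedure defining the free minimal spanning
forest. -/
def Survives (lbl : G.UEdge → ℝ) (e : G.E) : Prop := ¬ G.IsCut lbl e

/-- `μ` is the distribution of i.i.d. uniform-`[0,1]` labels on the unordered edges. -/
def IsIIDUniform (μ : Measure (G.UEdge → ℝ)) : Prop :=
  IsProbabilityMeasure μ ∧
    ∀ (s : Finset G.UEdge) (f : G.UEdge → Set ℝ), (∀ e ∈ s, MeasurableSet (f e)) →
      μ {lbl | ∀ e ∈ s, lbl e ∈ f e} = ∏ e ∈ s, volume (f e ∩ Set.Icc (0 : ℝ) 1)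

/-- Number of surviving oriented edges at `x₀` in the labelling `lbl`. -/
noncomputable def survivingDegree (lbl : G.UEdge → ℝ) (x₀ : G.V) : ℕ :=
  Nat.card {e : {e : G.E // G.tail e = x₀} // G.Survives lbl e.1}

end Multigraph

section Cayley

variable (Γ : Type) [Group Γ]

/-- Følner characterization of amenability for a group. -/
def FolnerAmenable : Prop :=
  ∀ (T : Finset Γ) (ε : ℝ), 0 < ε → ∃ F : Finset Γ, F.Nonempty ∧
    ∀ g ∈ T, letI := Classical.decEq Γ
      (((F.image (fun x => g * x)) \ F).card : ℝ) ≤ ε * F.card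

/-- The Cayley graph of a group `Γ` with respect to a finite symmetric generating
multi-set, given by an index type `ι`, a labelling `s : ι → Γ` and an involution
`inv : ι → ι` with `s (inv i) = (s i)⁻¹` (pairing each oriented edge with its opposite). -/
def mkCayley (ι : Type) (s : ι → Γ) (inv : ι → ι)
    (h1 : ∀ i, inv (inv i) = i) (h2 : ∀ i, s (inv i) = (s i)⁻¹)
    (h3 : ∀ i, inv i = i → s i ≠ 1) : Multigraph where
  V := Γ
  E := Γ × ι
  tail := Prod.fst
  head := fun e => s e.2 * e.1
  op := fun e => (s e.2 * e.1, inv e.2)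
  op_op := by rintro ⟨g, i⟩; simp [h1, h2]
  op_ne := by
    rintro ⟨g, i⟩ h
    rw [Prod.mk.injEq] at h
    refine h3 i h.2 ?_
    have hg : s i * g = g := h.1
    have : s i * g = 1 * g := by rw [one_mul]; exact hg
    exact mul_right_cancel this
  tail_op := fun _ => rfl
  head_op := by rintro ⟨g, i⟩; simp [h2]

/-- The product of the word `w` of length `k` in the letters `s i`. -/
def wordProd (ι : Type) (s : ι → Γ) (k : ℕ) (w : Fin k → ι) : Γ :=
  (List.ofFn fun j => s (w j)).prod

/-- The Cayley graph of `Γ` with respect to the multi-set `S^{[k]}` of words of length `k`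
in the multi-set `S = (s i)_{i : ι}` (with a chosen pairing `invk` of opposite words). -/
def wordCayley (ι : Type) (s : ι → Γ) (k : ℕ) (invk : (Fin k → ι) → (Fin k → ι))
    (h1 : ∀ w, invk (invk w) = w)
    (h2 : ∀ w, wordProd Γ ι s k (invk w) = (wordProd Γ ι s k w)⁻¹)
    (h3 : ∀ w, invk w = w → wordProd Γ ι s k w ≠ 1) : Multigraph :=
  mkCayley Γ (Fin k → ι) (wordProd Γ ι s k) invk h1 h2 h3

end Cayley

theorem pow_succ_le_of_supermultiplicative {a : ℕ → ℝ} (ha : ∀ n, 0 ≤ a n)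
    (hmul : ∀ m n, a m * a n ≤ a (m + n)) (m j : ℕ) : a m ^ (j + 1) ≤ a (m * (j + 1)) := by
  induction j with
  | zero => simp
  | succ j ih =>
    calc a m ^ (j + 1 + 1) = a m ^ (j + 1) * a m := pow_succ _ _
      _ ≤ a (m * (j + 1)) * a m := mul_le_mul_of_nonneg_right ih (ha m)
      _ ≤ a (m * (j + 1) + m) := hmul _ _
      _ = a (m * (j + 1 + 1)) := by congr 1

theorem rpow_inv_le_of_le_pow {x M : ℝ} {n : ℕ} (hn : n ≠ 0) (hx : 0 ≤ x) (hM : 0 ≤ M)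
    (h : x ≤ M ^ n) : x ^ ((n : ℝ)⁻¹) ≤ M := by
  calc x ^ ((n : ℝ)⁻¹) ≤ (M ^ n) ^ ((n : ℝ)⁻¹) := by gcongr
    _ = M := Real.pow_rpow_inv_natCast hM hn

theorem limsup_rpow_inv_le {a : ℕ → ℝ} {M : ℝ} (ha : ∀ n, 0 ≤ a n) (hM : 0 ≤ M)
    (h : ∀ n, n ≠ 0 → a n ≤ M ^ n) :
    limsup (fun n : ℕ => a n ^ ((n : ℝ)⁻¹)) atTop ≤ M := by
  refine limsup_le_of_le (IsCoboundedUnder.of_frequently_ge (a := 0) ?_) ?_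
  · exact (Eventually.of_forall fun n => Real.rpow_nonneg (ha n) _).frequently
  · filter_upwards [eventually_ne_atTop 0] with n hn
    exact rpow_inv_le_of_le_pow hn (ha n) hM (h n hn)

theorem isBoundedUnder_rpow_inv {a : ℕ → ℝ} {M : ℝ} (ha : ∀ n, 0 ≤ a n) (hM : 0 ≤ M)
    (h : ∀ n, n ≠ 0 → a n ≤ M ^ n) :
    IsBoundedUnder (· ≤ ·) atTop (fun n : ℕ => a n ^ ((n : ℝ)⁻¹)) := by
  refine isBoundedUnder_of_eventually_le (a := M) ?_
  filter_upwards [eventually_ne_atTop 0] with n hn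
  exact rpow_inv_le_of_le_pow hn (ha n) hM (h n hn)

theorem le_limsup_rpow_inv_pow {a : ℕ → ℝ} {M : ℝ} (ha : ∀ n, 0 ≤ a n) (hM : 0 ≤ M)
    (h : ∀ n, n ≠ 0 → a n ≤ M ^ n) (hmul : ∀ m n, a m * a n ≤ a (m + n)) {m : ℕ} (hm : m ≠ 0) :
    a m ≤ limsup (fun n : ℕ => a n ^ ((n : ℝ)⁻¹)) atTop ^ m := by
  have key : a m ^ ((m : ℝ)⁻¹) ≤ limsup (fun n : ℕ => a n ^ ((n : ℝ)⁻¹)) atTop := by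
    refine le_limsup_of_frequently_le ?_ (isBoundedUnder_rpow_inv ha hM h)
    rw [frequently_atTop]
    intro N
    refine ⟨m * (N + 1), by nlinarith [Nat.pos_of_ne_zero hm], ?_⟩
    calc a m ^ ((m : ℝ)⁻¹) = ((a m ^ (N + 1)) ^ (((N + 1 : ℕ) : ℝ)⁻¹)) ^ ((m : ℝ)⁻¹) := by
          rw [Real.pow_rpow_inv_natCast (ha m) (Nat.succ_ne_zero N)]
      _ = (a m ^ (N + 1)) ^ (((m * (N + 1) : ℕ) : ℝ)⁻¹) := by
          rw [← Real.rpow_mul (pow_nonneg (ha m) _)]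
          congr 1
          push_cast
          rw [mul_inv, mul_comm]
      _ ≤ _ := by
          exact Real.rpow_le_rpow (pow_nonneg (ha m) _)
            (pow_succ_le_of_supermultiplicative ha hmul m N) (by positivity)
  calc a m = (a m ^ ((m : ℝ)⁻¹)) ^ m := (Real.rpow_inv_natCast_pow (ha m) hm).symm
    _ ≤ _ := pow_le_pow_left₀ (Real.rpow_nonneg (ha m) _) key m

theorem limsup_rpow_inv_mul {a : ℕ → ℝ} {M : ℝ} (ha : ∀ n, 0 ≤ a n) (hM : 0 ≤ M)
    (h : ∀ n, n ≠ 0 → a n ≤ M ^ n) (hmul : ∀ m n, a m * a n ≤ a (m + n)) {k : ℕ} (hk : k ≠ 0) :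
    limsup (fun n : ℕ => a (k * n) ^ ((n : ℝ)⁻¹)) atTop =
      limsup (fun n : ℕ => a n ^ ((n : ℝ)⁻¹)) atTop ^ k := by
  have hb : ∀ n, n ≠ 0 → a (k * n) ≤ (M ^ k) ^ n := fun n hn => by
    rw [← pow_mul]; exact h _ (mul_ne_zero hk hn)
  have hbmul : ∀ m n, a (k * m) * a (k * n) ≤ a (k * (m + n)) := fun m n => by
    rw [mul_add]; exact hmul _ _
  have hL : 0 ≤ limsup (fun n : ℕ => a n ^ ((n : ℝ)⁻¹)) atTop :=
    le_limsup_of_frequently_le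
      (Eventually.of_forall fun n => Real.rpow_nonneg (ha n) _).frequently
      (isBoundedUnder_rpow_inv ha hM h)
  have hLk : 0 ≤ limsup (fun n : ℕ => a (k * n) ^ ((n : ℝ)⁻¹)) atTop :=
    le_limsup_of_frequently_le
      (Eventually.of_forall fun n => Real.rpow_nonneg (ha _) _).frequently
      (isBoundedUnder_rpow_inv (fun n => ha (k * n)) (pow_nonneg hM k) hb)
  apply le_antisymm
  · refine limsup_rpow_inv_le (fun n => ha (k * n)) (pow_nonneg hL k) fun n hn => ?_
    rw [← pow_mul]
    exact le_limsup_rpow_inv_pow ha hM h hmul (mul_ne_zero hk hn)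
  · set B := limsup (fun n : ℕ => a (k * n) ^ ((n : ℝ)⁻¹)) atTop
    have hroot : 0 ≤ B ^ ((k : ℝ)⁻¹) := Real.rpow_nonneg hLk _
    calc _ ≤ (B ^ ((k : ℝ)⁻¹)) ^ k := by
          refine pow_le_pow_left₀ hL (limsup_rpow_inv_le ha hroot fun m hm => ?_) k
          refine le_of_pow_le_pow_left₀ hk (pow_nonneg hroot m) ?_
          obtain ⟨j, rfl⟩ := Nat.exists_eq_succ_of_ne_zero hk
          calc a m ^ (j + 1) ≤ a (m * (j + 1)) :=
                pow_succ_le_of_supermultiplicative ha hmul m j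
            _ = a ((j + 1) * m) := by rw [mul_comm]
            _ ≤ B ^ m := le_limsup_rpow_inv_pow (fun n => ha ((j + 1) * n))
                (pow_nonneg hM _) hb hbmul hm
            _ = _ := by rw [← pow_mul, mul_comm, pow_mul, Real.rpow_inv_natCast_pow hLk hk]
      _ = B := Real.rpow_inv_natCast_pow hLk hk

theorem countable_of_closure_range_eq_top {Γ ι : Type*} [Group Γ] [Countable ι] {s : ι → Γ}
    (h : Subgroup.closure (Set.range s) = ⊤) : Countable Γ := by
  have hsurj : Function.Surjective (FreeGroup.lift s) := by
    rw [← MonoidHom.range_eq_top, FreeGroup.range_lift_eq_closure, h]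
  have : Countable (FreeGroup ι) := Quot.mk_surjective.countable
  exact hsurj.countable

namespace Multigraph

theorem isWalkFromTo_cons_iff (G : Multigraph) {n : ℕ} {e : G.E} {c : Fin n → G.E} {x y : G.V} :
    G.IsWalkFromTo (n + 1) (Fin.cons e c) x y ↔ G.tail e = x ∧ G.IsWalkFromTo n c (G.head e) y := by
  cases n with
  | zero =>
    constructor
    · rintro ⟨-, h, -⟩
      exact ⟨(h one_pos).1, fun i => i.elim0, fun h0 => absurd h0 (lt_irrefl 0),
        fun _ => (h one_pos).2⟩
    · rintro ⟨hx, -, -, hy⟩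
      exact ⟨fun i h => absurd h (by omega), fun _ => ⟨hx, hy rfl⟩, fun h => absurd h one_ne_zero⟩
  | succ n =>
    have hlast : (⟨n + 1, by omega⟩ : Fin (n + 2)) = Fin.succ ⟨n, by omega⟩ := rfl
    have hsucc (i : Fin (n + 1)) (h : (i : ℕ) + 1 + 1 < n + 2) :
        (⟨(i : ℕ) + 1 + 1, h⟩ : Fin (n + 2)) = Fin.succ ⟨(i : ℕ) + 1, by omega⟩ := rfl
    have hone (h : 0 + 1 < n + 2) : (⟨0 + 1, h⟩ : Fin (n + 2)) = Fin.succ ⟨0, by omega⟩ := rfl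
    have hzero : (⟨0, by omega⟩ : Fin (n + 2)) = 0 := rfl
    simp only [IsWalkFromTo, IsWalk, Fin.forall_fin_succ (n := n + 1), Fin.val_zero, Fin.val_succ,
      Fin.cons_zero, Fin.cons_succ, hlast, hsucc, hone, hzero, Nat.add_sub_cancel]
    simp only [Nat.zero_lt_succ, forall_true_left, Nat.succ_ne_zero, false_imp_iff, and_true,
      add_lt_add_iff_right, zero_add]
    constructor
    · rintro ⟨⟨h0, hw⟩, ht, hh⟩
      exact ⟨ht, hw, (h0 (by omega)).symm, hh⟩
    · rintro ⟨ht, hw, h0, hh⟩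
      exact ⟨⟨fun _ => h0.symm, hw⟩, ht, hh⟩

/-- A walk of length `n + 1` from `x` is an edge at `x` followed by a walk of length `n`. -/
def walkSuccEquiv (G : Multigraph) (n : ℕ) (x y : G.V) :
    {c : Fin (n + 1) → G.E // G.IsWalkFromTo (n + 1) c x y} ≃
      Σ e : {e : G.E // G.tail e = x}, {c : Fin n → G.E // G.IsWalkFromTo n c (G.head e) y} where
  toFun c :=
    have h := G.isWalkFromTo_cons_iff.1 ((Fin.cons_self_tail c.1).symm ▸ c.2)
    ⟨⟨c.1 0, h.1⟩, ⟨Fin.tail c.1, h.2⟩⟩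
  invFun p := ⟨Fin.cons p.1.1 p.2.1, G.isWalkFromTo_cons_iff.2 ⟨p.1.2, p.2.2⟩⟩
  left_inv c := by simp
  right_inv p := rfl

instance finite_walks (G : Multigraph) [∀ x, Finite {e : G.E // G.tail e = x}] (n : ℕ)
    (x y : G.V) : Finite {c : Fin n → G.E // G.IsWalkFromTo n c x y} := by
  induction n generalizing x with
  | zero => infer_instance
  | succ n ih => exact Finite.of_equiv _ (G.walkSuccEquiv n x y).symm

theorem pathCount_succ (G : Multigraph) [∀ x, Finite {e : G.E // G.tail e = x}] (n : ℕ)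
    (x y : G.V) [Fintype {e : G.E // G.tail e = x}] :
    G.pathCount (n + 1) x y = ∑ e : {e : G.E // G.tail e = x}, G.pathCount n (G.head e) y := by
  rw [pathCount, Nat.card_congr (G.walkSuccEquiv n x y), Nat.card_sigma]
  rfl

end Multigraph

section Cayley

variable {Γ : Type} [Group Γ] {ι : Type} {s : ι → Γ} {inv : ι → ι}
  {h1 : ∀ i, inv (inv i) = i} {h2 : ∀ i, s (inv i) = (s i)⁻¹} {h3 : ∀ i, inv i = i → s i ≠ 1}

/-- The edges of a Cayley graph at a given vertex are indexed by the generators. -/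
def mkCayleyEdgesEquiv (x : Γ) :
    ι ≃ {e : (mkCayley Γ ι s inv h1 h2 h3).E // (mkCayley Γ ι s inv h1 h2 h3).tail e = x} where
  toFun i := ⟨(x, i), rfl⟩
  invFun e := e.1.2
  left_inv _ := rfl
  right_inv := by rintro ⟨⟨y, i⟩, rfl⟩; rfl

variable [Fintype ι]

instance mkCayley_finite_edges (x : (mkCayley Γ ι s inv h1 h2 h3).V) :
    Finite {e : (mkCayley Γ ι s inv h1 h2 h3).E // (mkCayley Γ ι s inv h1 h2 h3).tail e = x} :=
  Finite.of_equiv _ (mkCayleyEdgesEquiv (Γ := Γ) x)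

/-- The sum of a multi-set of group elements in the group semiring. -/
noncomputable def generatorSum (s : ι → Γ) : MonoidAlgebra ℕ Γ :=
  ∑ i, MonoidAlgebra.single (s i) 1

theorem coeff_generatorSum_pow_succ (s : ι → Γ) (n : ℕ) (g : Γ) :
    (generatorSum s ^ (n + 1)).coeff g = ∑ i, (generatorSum s ^ n).coeff (g * (s i)⁻¹) := by
  rw [pow_succ, generatorSum, Finset.mul_sum, MonoidAlgebra.coeff_sum, Finsupp.finsetSum_apply]
  simp

theorem generatorSum_wordProd (s : ι → Γ) (k : ℕ) :
    generatorSum (wordProd Γ ι s k) = generatorSum s ^ k := by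
  induction k with
  | zero => simp [generatorSum, wordProd, MonoidAlgebra.one_def]
  | succ k ih =>
    rw [pow_succ', ← ih]
    simp only [generatorSum]
    rw [Finset.sum_mul_sum, ← Fintype.sum_prod_type',
      ← (Fin.consEquiv fun _ : Fin (k + 1) => ι).sum_comp]
    refine Finset.sum_congr rfl fun p _ => ?_
    rw [MonoidAlgebra.single_mul_single, one_mul]
    congr 1
    simp [wordProd, Fin.consEquiv]

theorem coeff_generatorSum_pow_le (s : ι → Γ) (n : ℕ) (g : Γ) :
    (generatorSum s ^ n).coeff g ≤ Fintype.card ι ^ n := by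
  induction n generalizing g with
  | zero =>
    rw [pow_zero, pow_zero, MonoidAlgebra.one_def, MonoidAlgebra.coeff_single]
    classical
    rw [Finsupp.single_apply]
    split_ifs <;> simp
  | succ n ih =>
    rw [coeff_generatorSum_pow_succ, pow_succ', ← smul_eq_mul, ← Finset.card_univ]
    exact Finset.sum_le_card_nsmul _ _ _ fun i _ => ih _

theorem coeff_one_mul_coeff_one_le (f g : MonoidAlgebra ℕ Γ) :
    f.coeff 1 * g.coeff 1 ≤ (f * g).coeff 1 := by
  conv_rhs => rw [← MonoidAlgebra.single_add_erase 1 f]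
  rw [add_mul, MonoidAlgebra.coeff_add, Finsupp.add_apply, MonoidAlgebra.coeff_single_one_mul]
  exact Nat.le_add_right _ _

theorem pathCount_mkCayley (n : ℕ) (x y : Γ) :
    (mkCayley Γ ι s inv h1 h2 h3).pathCount n x y = (generatorSum s ^ n).coeff (y * x⁻¹) := by
  induction n generalizing x with
  | zero =>
    rw [pow_zero, MonoidAlgebra.one_def, MonoidAlgebra.coeff_single]
    classical
    rw [Finsupp.single_apply]
    by_cases h : x = y
    · have : ∀ c, (mkCayley Γ ι s inv h1 h2 h3).IsWalkFromTo 0 c x y := fun c =>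
        ⟨fun i => i.elim0, fun h => absurd h (lt_irrefl 0), fun _ => h⟩
      rw [if_pos (mul_inv_eq_one.2 h.symm).symm]
      refine (Nat.card_congr (Equiv.subtypeUnivEquiv this)).trans ?_
      simp
    · have : ∀ c, ¬ (mkCayley Γ ι s inv h1 h2 h3).IsWalkFromTo 0 c x y := fun c hc =>
        h (hc.2.2 rfl)
      rw [if_neg fun h' => h (mul_inv_eq_one.1 h'.symm).symm]
      simp [Multigraph.pathCount, this]
  | succ n ih =>
    have := Fintype.ofEquiv _ (mkCayleyEdgesEquiv (h1 := h1) (h2 := h2) (h3 := h3) x)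
    refine (Multigraph.pathCount_succ (mkCayley Γ ι s inv h1 h2 h3) n x y).trans ?_
    rw [coeff_generatorSum_pow_succ,
      ← (mkCayleyEdgesEquiv (h1 := h1) (h2 := h2) (h3 := h3) x).sum_comp]
    refine Finset.sum_congr rfl fun i _ => ?_
    refine (ih (s i * x)).trans ?_
    rw [mul_inv_rev, mul_assoc]

end Cayley

namespace Multigraph

variable {G : Multigraph}

theorem uedge_eq_iff {e f : G.E} : G.uedge e = G.uedge f ↔ f = e ∨ f = G.op e := by
  constructor
  · intro h
    have hlift := congrArg (Quot.lift (fun e => s(e, G.op e)) (by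
      rintro a b rfl
      rw [G.op_op, Sym2.eq_swap])) h
    rcases Sym2.eq_iff.1 hlift with h | h
    · exact Or.inl h.1.symm
    · exact Or.inr h.2.symm
  · rintro (rfl | rfl)
    · rfl
    · exact Quot.sound rfl

theorem uedge_op (e : G.E) : G.uedge (G.op e) = G.uedge e :=
  (uedge_eq_iff.2 (Or.inr rfl)).symm

theorem isWalkFromTo_self_iff {m : ℕ} {c : Fin (m + 1) → G.E} {x : G.V} :
    G.IsWalkFromTo (m + 1) c x x ↔
      (∀ i, G.head (c i) = G.tail (c (i + 1))) ∧ G.tail (c 0) = x := by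
  have hlast : (⟨m + 1 - 1, by omega⟩ : Fin (m + 1)) = Fin.last m := rfl
  constructor
  · rintro ⟨hw, hend, -⟩
    obtain ⟨h0, h1⟩ := hend (Nat.succ_pos m)
    refine ⟨fun i => ?_, h0⟩
    by_cases hi : (i : ℕ) + 1 < m + 1
    · rw [hw i hi]
      congr 2
      exact Fin.ext (Fin.val_add_one_of_lt (Fin.lt_def.2 (by simpa using hi))).symm
    · obtain rfl : i = Fin.last m := Fin.ext (by simp; omega)
      rw [Fin.last_add_one]
      exact h1.trans h0.symm
  · rintro ⟨hw, h0⟩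
    refine ⟨fun i hi => ?_, fun _ => ⟨h0, ?_⟩, fun h => absurd h (Nat.succ_ne_zero m)⟩
    · rw [hw i]
      congr 2
      exact Fin.ext (Fin.val_add_one_of_lt (Fin.lt_def.2 (by simpa using hi)))
    · rw [hlast, hw, Fin.last_add_one, h0]

theorem isSimpleCycle_iff {m : ℕ} {c : Fin (m + 1) → G.E} {x : G.V} :
    G.IsSimpleCycle (m + 1) c x ↔
      (∀ i, G.head (c i) = G.tail (c (i + 1))) ∧ G.tail (c 0) = x ∧
        Function.Injective (fun i => G.tail (c i)) ∧
        Function.Injective (fun i => G.uedge (c i)) := by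
  rw [IsSimpleCycle, isWalkFromTo_self_iff]
  constructor
  · rintro ⟨-, ⟨hw, h0⟩, hinj, hback⟩
    refine ⟨hw, h0, hinj, fun i j hij => ?_⟩
    rcases uedge_eq_iff.1 hij with h | h
    · exact hinj (congrArg G.tail h.symm)
    · by_contra hne
      have hj : j = i + 1 := hinj (by simp only [h, G.tail_op, hw])
      have hi : i = j + 1 := hinj (by simp only [← hw, h, G.head_op])
      have h2 : (1 : Fin (m + 1)) + 1 = 0 := by
        rw [hj, add_assoc] at hi
        exact left_eq_add.1 hi
      have hm : m = 1 := by
        have hm0 : m ≠ 0 := by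
          rintro rfl
          exact hne (Subsingleton.elim (α := Fin 1) i j)
        by_contra hm1
        have := congrArg Fin.val h2
        rw [Fin.val_add, Fin.val_one', Nat.mod_eq_of_lt (by omega : 1 < m + 1),
          Nat.mod_eq_of_lt (by omega)] at this
        simp at this
      subst hm
      have hb := hback rfl
      have hor : i = 0 ∧ j = 1 ∨ i = 1 ∧ j = 0 := by omega
      rcases hor with ⟨rfl, rfl⟩ | ⟨rfl, rfl⟩
      · exact hb h
      · exact hb (by rw [show (⟨0, by omega⟩ : Fin 2) = 0 from rfl, h, G.op_op]; rfl)
  · rintro ⟨hw, h0, hinj, huinj⟩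
    refine ⟨by omega, ⟨hw, h0⟩, hinj, fun h hback => ?_⟩
    have := huinj (a₁ := ⟨1, by omega⟩) (a₂ := ⟨0, by omega⟩) (by
      simp only [hback, uedge_op])
    simp at this

/-- A simple cycle through an edge can be rotated and reversed so as to start with that edge. -/
theorem IsSimpleCycle.exists_apply_zero_eq {m : ℕ} {c : Fin (m + 1) → G.E} {x : G.V}
    (hc : G.IsSimpleCycle (m + 1) c x) {i : Fin (m + 1)} {e : G.E}
    (hi : c i = e ∨ c i = G.op e) :
    ∃ c' : Fin (m + 1) → G.E, G.IsSimpleCycle (m + 1) c' (G.tail e) ∧ c' 0 = e ∧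
      ∀ j, ∃ j', G.uedge (c' j) = G.uedge (c j') := by
  obtain ⟨hw, -, hinj, huinj⟩ := isSimpleCycle_iff.1 hc
  rcases hi with hi | hi
  · refine ⟨fun j => c (j + i), isSimpleCycle_iff.2 ⟨fun j => ?_, ?_, ?_, ?_⟩, ?_,
      fun j => ⟨j + i, rfl⟩⟩
    · rw [hw, add_right_comm]
    · rw [zero_add, hi]
    · exact hinj.comp (add_left_injective i)
    · exact huinj.comp (add_left_injective i)
    · simp only [zero_add, hi]
  · have hi' : G.op (c i) = e := by rw [hi, G.op_op]
    refine ⟨fun j => G.op (c (i - j)), isSimpleCycle_iff.2 ⟨fun j => ?_, ?_, ?_, ?_⟩, ?_,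
      fun j => ⟨i - j, uedge_op _⟩⟩
    · rw [G.head_op, G.tail_op, hw]
      congr 2
      abel
    · rw [sub_zero, hi']
    · have : (fun j => G.tail (G.op (c (i - j)))) = fun j => G.tail (c (i - j + 1)) := by
        funext j
        rw [G.tail_op, hw]
      rw [this]
      exact hinj.comp ((add_left_injective 1).comp sub_right_injective)
    · simp only [uedge_op]
      exact huinj.comp sub_right_injective
    · simp only [sub_zero, hi']

theorem IsCut.exists_cycle {lbl : G.UEdge → ℝ} {e : G.E} (h : G.IsCut lbl e) :
    ∃ (m : ℕ) (c : Fin (m + 1) → G.E), G.IsSimpleCycle (m + 1) c (G.tail e) ∧ c 0 = e ∧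
      ∀ j, lbl (G.uedge (c j)) ≤ lbl (G.uedge e) := by
  obtain ⟨n, x, c, hc, i, hi, hmax⟩ := h
  obtain ⟨m, rfl⟩ := Nat.exists_eq_succ_of_ne_zero (Nat.one_le_iff_ne_zero.1 hc.1)
  obtain ⟨c', hc', h0, hu⟩ := hc.exists_apply_zero_eq hi
  refine ⟨m, c', hc', h0, fun j => ?_⟩
  obtain ⟨j', hj'⟩ := hu j
  have he : G.uedge (c i) = G.uedge e := by
    rcases hi with hi | hi
    · rw [hi]
    · rw [hi, uedge_op]
  rw [hj', ← he]
  exact hmax j'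

/-- For pairwise distinct labels, the edge of minimal label among the non-loops at a vertex
survives. -/
theorem exists_survives {lbl : G.UEdge → ℝ} (hlbl : Function.Injective lbl) {x : G.V}
    [Finite {e : G.E // G.tail e = x}] {f : G.E} (hf : G.tail f = x) (hf' : G.head f ≠ x) :
    ∃ e, G.tail e = x ∧ G.Survives lbl e := by
  have hfin : {e : G.E | G.tail e = x ∧ G.head e ≠ x}.Finite :=
    Set.Finite.subset (s := {e : G.E | G.tail e = x}) ‹_› fun e he => he.1
  obtain ⟨e, ⟨he, he'⟩, hmin⟩ :=
    Set.exists_min_image _ (fun e => lbl (G.uedge e)) hfin ⟨f, hf, hf'⟩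
  refine ⟨e, he, fun hcut => ?_⟩
  obtain ⟨m, c, hc, h0, hmax⟩ := hcut.exists_cycle
  obtain ⟨hw, -, hinj, huinj⟩ := isSimpleCycle_iff.1 hc
  have hback : G.head (c (-1)) = x := by rw [hw, neg_add_cancel, h0, he]
  have hne : (-1 : Fin (m + 1)) ≠ 0 := by
    intro h
    rw [h, h0] at hback
    exact he' hback
  have htail : G.tail (c (-1)) ≠ x := by
    rw [← he, ← h0]
    exact fun h => hne (hinj h)
  have hle := hmin (G.op (c (-1))) ⟨by rw [G.tail_op, hback], by rwa [G.head_op]⟩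
  simp only [uedge_op] at hle
  have heq := hlbl (le_antisymm hle (hmax (-1)))
  exact hne (huinj (by simp only [h0, heq]))

end Multigraph

namespace Multigraph

variable {G : Multigraph} {μ : Measure (G.UEdge → ℝ)}

theorem IsIIDUniform.measure_forall_le (hμ : G.IsIIDUniform μ) (s : Finset G.UEdge) {p : ℝ}
    (hp : p ≤ 1) : μ {lbl | ∀ e ∈ s, lbl e ≤ p} = ENNReal.ofReal p ^ s.card := by
  have hvol : volume (Set.Iic p ∩ Set.Icc (0 : ℝ) 1) = ENNReal.ofReal p := by
    have : Set.Iic p ∩ Set.Icc (0 : ℝ) 1 = Set.Icc 0 p := by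
      ext y
      simp only [Set.mem_inter_iff, Set.mem_Iic, Set.mem_Icc]
      constructor
      · exact fun h => ⟨h.2.1, h.1⟩
      · exact fun h => ⟨h.2, h.1, h.2.trans hp⟩
    rw [this, Real.volume_Icc, sub_zero]
  simpa [hvol] using hμ.2 s (fun _ => Set.Iic p) fun _ _ => measurableSet_Iic

theorem IsIIDUniform.ae_injective [Countable G.UEdge] (hμ : G.IsIIDUniform μ) :
    ∀ᵐ lbl ∂μ, Function.Injective lbl := by
  classical
  have hne : ∀ a b : G.UEdge, a ≠ b → ∀ᵐ lbl ∂μ, lbl a ≠ lbl b := by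
    intro a b hab
    let U : Measure ℝ := volume.restrict (Set.Icc 0 1)
    have hmeas : Measurable fun lbl : G.UEdge → ℝ => (lbl a, lbl b) := by fun_prop
    have hmap : U.prod U = μ.map fun lbl => (lbl a, lbl b) := by
      refine Measure.prod_eq fun s t hs ht => ?_
      have h := hμ.2 {a, b} (fun e => if e = a then s else t) fun e _ => by
        split_ifs
        exacts [hs, ht]
      rw [Finset.prod_pair hab, if_pos rfl, if_neg hab.symm] at h
      rw [Measure.map_apply hmeas (hs.prod ht), Measure.restrict_apply hs,
        Measure.restrict_apply ht, ← h]
      congr 1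
      ext lbl
      simp [hab.symm]
    have hdiag : U.prod U (Set.diagonal ℝ) = 0 := by
      rw [Measure.measure_prod_null measurableSet_diagonal]
      refine Eventually.of_forall fun y => ?_
      have : Prod.mk y ⁻¹' Set.diagonal ℝ = {y} := by
        ext z
        simp [eq_comm]
      simp [this]
    rw [hmap, Measure.map_apply hmeas measurableSet_diagonal] at hdiag
    rw [ae_iff]
    simpa [Set.preimage, Set.mem_diagonal_iff] using hdiag
  have hall : ∀ᵐ lbl ∂μ, ∀ a b : G.UEdge, a ≠ b → lbl a ≠ lbl b := by
    rw [ae_all_iff]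
    intro a
    rw [ae_all_iff]
    intro b
    by_cases hab : a = b
    · simp [hab]
    · filter_upwards [hne a b hab] with lbl h _ using h
  filter_upwards [hall] with lbl h a b hab
  by_contra hne
  exact h a b hne hab

theorem measurableSet_survives [Countable G.V] [Countable G.E] (e : G.E) :
    MeasurableSet {lbl | G.Survives lbl e} := by
  have : Measurable fun lbl => G.IsCut lbl e := by
    unfold IsCut
    refine Measurable.exists fun n => Measurable.exists fun x => Measurable.exists fun c => ?_
    refine measurable_const.and (Measurable.exists fun i => measurable_const.and ?_)
    refine Measurable.forall fun j => ?_
    exact measurableSet_setOfPred.1 (measurableSet_le (measurable_pi_apply _) (measurable_pi_apply _))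
  exact (measurableSet_setOfPred.2 this).compl

theorem integral_survivingDegree [Countable G.V] [Countable G.E] [IsProbabilityMeasure μ]
    (x : G.V) [Fintype {e : G.E // G.tail e = x}] :
    ∫ lbl, (G.survivingDegree lbl x : ℝ) ∂μ =
      ∑ e : {e : G.E // G.tail e = x}, μ.real {lbl | G.Survives lbl e.1} := by
  classical
  have hdeg : ∀ lbl, (G.survivingDegree lbl x : ℝ) =
      ∑ e : {e : G.E // G.tail e = x}, {lbl | G.Survives lbl e.1}.indicator (1 : (G.UEdge → ℝ) → ℝ) lbl := by
    intro lbl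
    rw [survivingDegree, Nat.card_eq_fintype_card, Fintype.card_subtype, Finset.card_filter]
    push_cast
    exact Finset.sum_congr rfl fun e _ => by simp [Set.indicator_apply]
  simp_rw [hdeg]
  rw [integral_finsetSum]
  · exact Finset.sum_congr rfl fun e _ => integral_indicator_one (measurableSet_survives e.1)
  · exact fun e _ => (integrable_const (1 : ℝ)).indicator (measurableSet_survives e.1)

/-- If an edge has a label at most `p`, then it survives or it is the first edge of a simple cycle
all of whose labels are at most `p`. -/
theorem IsIIDUniform.ofReal_le_measure_survives_add (hμ : G.IsIIDUniform μ) [Countable G.E]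
    [DecidableEq G.E] {p : ℝ} (hp : p ≤ 1) {x : G.V} {e : G.E} (he : G.tail e = x) :
    ENNReal.ofReal p ≤ μ {lbl | G.Survives lbl e} +
      ∑' (m : ℕ) (c : {c : Fin (m + 1) → G.E // G.IsWalkFromTo (m + 1) c x x}),
        if c.1 0 = e then ENNReal.ofReal p ^ (m + 1) else 0 := by
  classical
  let T (m : ℕ) (c : {c : Fin (m + 1) → G.E // G.IsWalkFromTo (m + 1) c x x}) :
      Set (G.UEdge → ℝ) :=
    {lbl | (c.1 0 = e ∧ G.IsSimpleCycle (m + 1) c.1 x) ∧ ∀ j, lbl (G.uedge (c.1 j)) ≤ p}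
  have hT : ∀ m c, μ (T m c) ≤ if c.1 0 = e then ENNReal.ofReal p ^ (m + 1) else 0 := by
    intro m c
    by_cases hc : c.1 0 = e ∧ G.IsSimpleCycle (m + 1) c.1 x
    · have hinj := (isSimpleCycle_iff.1 hc.2).2.2.2
      have h := hμ.measure_forall_le (Finset.univ.image fun j => G.uedge (c.1 j)) hp
      rw [Finset.card_image_of_injective _ hinj, Finset.card_univ, Fintype.card_fin] at h
      rw [if_pos hc.1, ← h]
      refine measure_mono fun lbl hlbl => ?_
      simpa using hlbl.2
    · have : T m c = ∅ := Set.eq_empty_of_forall_notMem fun lbl hlbl => hc hlbl.1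
      simp [this]
  have hsub : {lbl : G.UEdge → ℝ | lbl (G.uedge e) ≤ p} ⊆
      {lbl | G.Survives lbl e} ∪ ⋃ m, ⋃ c, T m c := by
    intro lbl hlbl
    by_cases hcut : G.IsCut lbl e
    · obtain ⟨m, c, hc, h0, hmax⟩ := hcut.exists_cycle
      rw [he] at hc
      refine Or.inr (Set.mem_iUnion₂.2 ⟨m, ⟨c, hc.2.1⟩, ⟨h0, hc⟩, fun j => (hmax j).trans hlbl⟩)
    · exact Or.inl hcut
  calc ENNReal.ofReal p = μ {lbl | lbl (G.uedge e) ≤ p} := by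
        simpa using (hμ.measure_forall_le {G.uedge e} hp).symm
    _ ≤ μ ({lbl | G.Survives lbl e} ∪ ⋃ m, ⋃ c, T m c) := measure_mono hsub
    _ ≤ μ {lbl | G.Survives lbl e} + μ (⋃ m, ⋃ c, T m c) := measure_union_le _ _
    _ ≤ _ := by
        gcongr
        refine (measure_iUnion_le _).trans (ENNReal.tsum_le_tsum fun m => ?_)
        exact (measure_iUnion_le _).trans (ENNReal.tsum_le_tsum fun c => hT m c)

theorem IsIIDUniform.card_mul_ofReal_le (hμ : G.IsIIDUniform μ) [Countable G.E]
    [∀ y, Finite {e : G.E // G.tail e = y}] {x : G.V} [Fintype {e : G.E // G.tail e = x}]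
    {R : ℝ} (hR : 1 ≤ R) (hpath : ∀ n, n ≠ 0 → (G.pathCount n x x : ℝ) ≤ R ^ n) :
    Fintype.card {e : G.E // G.tail e = x} * ENNReal.ofReal (1 / (2 * R)) ≤
      ∑ e : {e : G.E // G.tail e = x}, μ {lbl | G.Survives lbl e.1} + 1 := by
  classical
  set p : ℝ := 1 / (2 * R) with hp
  have hp0 : 0 ≤ p := by positivity
  have hp1 : p ≤ 1 := by rw [hp, div_le_one (by positivity)]; linarith
  have hRp : R * p = 2⁻¹ := by rw [hp]; field_simp
  have hcycles : ∑ e : {e : G.E // G.tail e = x}, ∑' (m : ℕ)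
      (c : {c : Fin (m + 1) → G.E // G.IsWalkFromTo (m + 1) c x x}),
        (if c.1 0 = e.1 then ENNReal.ofReal p ^ (m + 1) else 0) ≤ 1 := by
    rw [← tsum_fintype (L := .unconditional _), ENNReal.tsum_comm]
    calc _ ≤ ∑' m : ℕ, (2⁻¹ : ENNReal) ^ (m + 1) := by
          refine ENNReal.tsum_le_tsum fun m => ?_
          rw [ENNReal.tsum_comm]
          calc _ ≤ ∑' _ : {c : Fin (m + 1) → G.E // G.IsWalkFromTo (m + 1) c x x},
                ENNReal.ofReal p ^ (m + 1) := by
                refine ENNReal.tsum_le_tsum fun c => ?_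
                rw [tsum_eq_single ⟨c.1 0, (c.2.2.1 (Nat.succ_pos m)).1⟩]
                · split_ifs <;> simp
                · intro e he
                  exact if_neg fun h => he (Subtype.ext h.symm)
            _ = G.pathCount (m + 1) x x * ENNReal.ofReal p ^ (m + 1) := by
                have := Fintype.ofFinite
                  {c : Fin (m + 1) → G.E // G.IsWalkFromTo (m + 1) c x x}
                rw [tsum_fintype, Finset.sum_const, Finset.card_univ, pathCount,
                  Nat.card_eq_fintype_card, nsmul_eq_mul]
            _ ≤ ENNReal.ofReal R ^ (m + 1) * ENNReal.ofReal p ^ (m + 1) := by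
                gcongr
                rw [← ENNReal.ofReal_pow (by positivity), ← ENNReal.ofReal_natCast]
                exact ENNReal.ofReal_le_ofReal (hpath _ (Nat.succ_ne_zero m))
            _ = 2⁻¹ ^ (m + 1) := by
                rw [← mul_pow, ← ENNReal.ofReal_mul (by positivity), hRp,
                  ENNReal.ofReal_inv_of_pos two_pos, ENNReal.ofReal_ofNat]
      _ = 1 := by
          rw [ENNReal.tsum_geometric_add_one, ENNReal.one_sub_inv_two, inv_inv]
          exact ENNReal.inv_mul_cancel (by simp) (by simp)
  calc _ = ∑ _ : {e : G.E // G.tail e = x}, ENNReal.ofReal p := by simp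
    _ ≤ _ := Finset.sum_le_sum fun e _ => hμ.ofReal_le_measure_survives_add hp1 e.2
    _ ≤ _ := by
        rw [Finset.sum_add_distrib]
        gcongr

theorem IsIIDUniform.one_le_sum_survives (hμ : G.IsIIDUniform μ) [Countable G.E] {x : G.V}
    [Fintype {e : G.E // G.tail e = x}] {f : G.E} (hf : G.tail f = x) (hf' : G.head f ≠ x) :
    1 ≤ ∑ e : {e : G.E // G.tail e = x}, μ {lbl | G.Survives lbl e.1} := by
  have := hμ.1
  have : Countable G.UEdge := Quot.mk_surjective.countable
  calc (1 : ENNReal) = μ Set.univ := measure_univ.symm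
    _ ≤ μ (⋃ e : {e : G.E // G.tail e = x}, {lbl | G.Survives lbl e.1}) := by
        refine measure_mono_ae ?_
        filter_upwards [hμ.ae_injective] with lbl hlbl _
        obtain ⟨e, he, hs⟩ := exists_survives hlbl hf hf'
        exact Set.mem_iUnion.2 ⟨⟨e, he⟩, hs⟩
    _ ≤ _ := measure_iUnion_fintype_le _ _

/-- A lower bound on the expected degree of the free minimal spanning forest at `x` in terms of
an exponential bound on the number of cycles rooted at `x`. -/
theorem IsIIDUniform.le_integral_survivingDegree (hμ : G.IsIIDUniform μ) [Countable G.V]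
    [Countable G.E] [∀ y, Finite {e : G.E // G.tail e = y}] {x : G.V} {R : ℝ} (hR : 1 ≤ R)
    (hpath : ∀ n, n ≠ 0 → (G.pathCount n x x : ℝ) ≤ R ^ n)
    (hcard : R < Nat.card {e : G.E // G.tail e = x}) :
    Nat.card {e : G.E // G.tail e = x} / (4 * R) - 1 / 4 ≤
      ∫ lbl, (G.survivingDegree lbl x : ℝ) ∂μ := by
  have := hμ.1
  have := Fintype.ofFinite {e : G.E // G.tail e = x}
  rw [integral_survivingDegree, Nat.card_eq_fintype_card] at *
  obtain ⟨f, hf, hf'⟩ : ∃ f, G.tail f = x ∧ G.head f ≠ x := by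
    by_contra! hloop
    have hle := hpath 1 one_ne_zero
    have hzero : ∀ e : {e : G.E // G.tail e = x}, G.pathCount 0 (G.head e.1) x = 1 := by
      intro e
      rw [hloop e.1 e.2, pathCount, Nat.card_congr (Equiv.subtypeUnivEquiv fun c =>
        ⟨fun i => i.elim0, fun h => absurd h (lt_irrefl 0), fun _ => rfl⟩)]
      simp
    rw [pow_one, ← zero_add 1, pathCount_succ] at hle
    simp only [hzero, Finset.sum_const, Finset.card_univ, smul_eq_mul, mul_one] at hle
    linarith
  have hfin : ∑ e : {e : G.E // G.tail e = x}, μ {lbl | G.Survives lbl e.1} ≠ ⊤ :=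
    ENNReal.sum_ne_top.2 fun e _ => measure_ne_top _ _
  have hone := ENNReal.toReal_mono hfin (hμ.one_le_sum_survives hf hf')
  have hbound := ENNReal.toReal_mono (ENNReal.add_ne_top.2 ⟨hfin, ENNReal.one_ne_top⟩)
    (hμ.card_mul_ofReal_le hR hpath)
  rw [ENNReal.toReal_add hfin ENNReal.one_ne_top, ENNReal.toReal_mul, ENNReal.toReal_natCast,
    ENNReal.toReal_ofReal (by positivity)] at hbound
  rw [ENNReal.toReal_sum fun e _ => measure_ne_top _ _] at hone hbound
  simp only [ENNReal.toReal_one, ← measureReal_def] at hone hbound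
  have : (Fintype.card {e : G.E // G.tail e = x} : ℝ) / (4 * R) =
      (Fintype.card {e : G.E // G.tail e = x} * (1 / (2 * R))) / 2 := by
    field_simp
    norm_num
  rw [this]
  linarith

end Multigraph

section Cayley

variable {Γ : Type} [Group Γ] {ι : Type} [Fintype ι] {s : ι → Γ}

/-- The exponential growth rate of the number of words of length `n` with trivial product. -/
noncomputable def returnRate (s : ι → Γ) : ℝ :=
  limsup (fun n : ℕ => ((generatorSum s ^ n).coeff 1 : ℝ) ^ ((n : ℝ)⁻¹)) atTop

theorem cast_coeff_generatorSum_pow_le (s : ι → Γ) (n : ℕ) :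
    ((generatorSum s ^ n).coeff 1 : ℝ) ≤ (Fintype.card ι : ℝ) ^ n := by
  exact_mod_cast coeff_generatorSum_pow_le s n 1

theorem coeff_generatorSum_pow_mul_le (s : ι → Γ) (m n : ℕ) :
    ((generatorSum s ^ m).coeff 1 : ℝ) * ((generatorSum s ^ n).coeff 1 : ℝ) ≤
      ((generatorSum s ^ (m + n)).coeff 1 : ℝ) := by
  rw [pow_add]
  exact_mod_cast coeff_one_mul_coeff_one_le _ _

theorem coeff_generatorSum_pow_le_returnRate_pow (s : ι → Γ) {n : ℕ} (hn : n ≠ 0) :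
    ((generatorSum s ^ n).coeff 1 : ℝ) ≤ returnRate s ^ n :=
  le_limsup_rpow_inv_pow (a := fun n => ((generatorSum s ^ n).coeff 1 : ℝ))
    (fun _ => Nat.cast_nonneg _) (Nat.cast_nonneg _)
    (fun n _ => cast_coeff_generatorSum_pow_le s n) (coeff_generatorSum_pow_mul_le s) hn

theorem returnRate_wordProd (s : ι → Γ) {k : ℕ} (hk : k ≠ 0) :
    returnRate (wordProd Γ ι s k) = returnRate s ^ k := by
  simp only [returnRate, generatorSum_wordProd, ← pow_mul]
  exact limsup_rpow_inv_mul (a := fun n => ((generatorSum s ^ n).coeff 1 : ℝ))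
    (fun _ => Nat.cast_nonneg _) (Nat.cast_nonneg _)
    (fun n _ => cast_coeff_generatorSum_pow_le s n) (coeff_generatorSum_pow_mul_le s) hk

theorem one_le_returnRate {inv : ι → ι} (h2 : ∀ i, s (inv i) = (s i)⁻¹) [Nonempty ι] :
    1 ≤ returnRate s := by
  have hgen : ∀ i, 1 ≤ (generatorSum s ^ 1).coeff (s i) := fun i => by
    rw [coeff_generatorSum_pow_succ s 0]
    refine le_trans ?_ (Finset.single_le_sum (fun _ _ => Nat.zero_le _) (Finset.mem_univ i))
    simp [MonoidAlgebra.one_def]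
  have htwo : 1 ≤ (generatorSum s ^ 2).coeff 1 := by
    obtain ⟨i⟩ := ‹Nonempty ι›
    rw [coeff_generatorSum_pow_succ s 1]
    refine le_trans ?_ (Finset.single_le_sum (fun _ _ => Nat.zero_le _) (Finset.mem_univ i))
    rw [one_mul, ← h2]
    exact hgen _
  have hnonneg : 0 ≤ returnRate s :=
    (Nat.cast_nonneg _).trans
      ((coeff_generatorSum_pow_le_returnRate_pow s one_ne_zero).trans_eq (pow_one _))
  rw [← one_le_sq_iff₀ hnonneg]
  exact le_trans (by exact_mod_cast htwo)
    (coeff_generatorSum_pow_le_returnRate_pow s two_ne_zero)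

variable {inv : ι → ι} {h1 : ∀ i, inv (inv i) = i} {h2 : ∀ i, s (inv i) = (s i)⁻¹}
  {h3 : ∀ i, inv i = i → s i ≠ 1}

theorem pathCount_mkCayley_one (n : ℕ) :
    (mkCayley Γ ι s inv h1 h2 h3).pathCount n (1 : Γ) (1 : Γ) =
      (generatorSum s ^ n).coeff 1 := by
  refine (pathCount_mkCayley n (1 : Γ) 1).trans ?_
  rw [inv_one, mul_one]

theorem spectralRadius_mkCayley (d : ℕ) :
    (mkCayley Γ ι s inv h1 h2 h3).spectralRadius d (1 : Γ) = returnRate s / d := by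
  have : (fun n : ℕ => (((mkCayley Γ ι s inv h1 h2 h3).pathCount n (1 : Γ) (1 : Γ) : ℕ) : ℝ) ^
      ((n : ℝ)⁻¹)) = fun n : ℕ => ((generatorSum s ^ n).coeff 1 : ℝ) ^ ((n : ℝ)⁻¹) := by
    funext n
    rw [pathCount_mkCayley_one]
  refine (congrArg (fun u => 1 / (d : ℝ) * limsup u atTop) this).trans ?_
  rw [one_div_mul_eq_div, returnRate]

theorem le_integral_survivingDegree_mkCayley [Nonempty ι] [Countable Γ]
    {μ : Measure ((mkCayley Γ ι s inv h1 h2 h3).UEdge → ℝ)}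
    (hμ : (mkCayley Γ ι s inv h1 h2 h3).IsIIDUniform μ)
    (hcard : returnRate s < Fintype.card ι) :
    Fintype.card ι / (4 * returnRate s) - 1 / 4 ≤
      ∫ lbl, ((mkCayley Γ ι s inv h1 h2 h3).survivingDegree lbl (1 : Γ) : ℝ) ∂μ := by
  have : Countable (mkCayley Γ ι s inv h1 h2 h3).V := ‹Countable Γ›
  have : Countable (mkCayley Γ ι s inv h1 h2 h3).E := inferInstanceAs (Countable (Γ × ι))
  have hdeg : Nat.card {e : (mkCayley Γ ι s inv h1 h2 h3).E //
      (mkCayley Γ ι s inv h1 h2 h3).tail e = (1 : Γ)} = Fintype.card ι := by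
    rw [← Nat.card_eq_fintype_card]
    exact (Nat.card_congr (mkCayleyEdgesEquiv (1 : Γ))).symm
  have h := hμ.le_integral_survivingDegree (x := (1 : Γ)) (one_le_returnRate h2)
    (fun n hn => (congrArg (Nat.cast (R := ℝ)) (pathCount_mkCayley_one n)).trans_le
      (coeff_generatorSum_pow_le_returnRate_pow s hn))
    (hcard.trans_eq (congrArg (Nat.cast (R := ℝ)) hdeg.symm))
  rwa [hdeg] at h

end Cayley

open Multigraph MeasureTheory Filter

/-- Let `Γ` be a finitely generated non-amenable group with finite symmetric
generating multi-set `S` (given by `s : ι → Γ` with pairing involution `inv`), and let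
`λ < 1` be the spectral radius of `Cay(Γ,S)`. For the generating multi-set `S^{[k]}` of
words of length `k` in `S` (with any pairing `invk`), the spectral radius of
`Cay(Γ,S^{[k]})` is `λ^k`; consequently the expected FMSF degree satisfies
`δ_FMSF(Γ,S^{[k]}) ≥ 1/(4λ^k) − 1/4`, which tends to infinity as `k → ∞`. -/
theorem fmsf_degree_of_word_powers (Γ : Type) [Group Γ] (hΓ : ¬ FolnerAmenable Γ)
    (ι : Type) [Fintype ι] (hι : 1 ≤ Fintype.card ι)
    (s : ι → Γ) (inv : ι → ι)
    (h1 : ∀ i, inv (inv i) = i) (h2 : ∀ i, s (inv i) = (s i)⁻¹)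
    (h3 : ∀ i, inv i = i → s i ≠ 1)
    (hgen : Subgroup.closure (Set.range s) = ⊤)
    (lam : ℝ)
    (hlam : lam = (mkCayley Γ ι s inv h1 h2 h3).spectralRadius (Fintype.card ι) (1 : Γ))
    (hlam1 : lam < 1) :
    (∀ (k : ℕ), 1 ≤ k → ∀ (invk : (Fin k → ι) → (Fin k → ι))
        (hk1 : ∀ w, invk (invk w) = w)
        (hk2 : ∀ w, wordProd Γ ι s k (invk w) = (wordProd Γ ι s k w)⁻¹)
        (hk3 : ∀ w, invk w = w → wordProd Γ ι s k w ≠ 1),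
      (wordCayley Γ ι s k invk hk1 hk2 hk3).spectralRadius (Fintype.card ι ^ k) (1 : Γ)
          = lam ^ k ∧
      ∀ (μ : Measure ((wordCayley Γ ι s k invk hk1 hk2 hk3).UEdge → ℝ)),
        (wordCayley Γ ι s k invk hk1 hk2 hk3).IsIIDUniform μ →
        ∀ δ : ℝ, δ = ∫ lbl,
            ((wordCayley Γ ι s k invk hk1 hk2 hk3).survivingDegree lbl (1 : Γ) : ℝ) ∂μ →
          1 / (4 * lam ^ k) - 1 / 4 ≤ δ) ∧
    Tendsto (fun k : ℕ => 1 / (4 * lam ^ k) - 1 / 4) atTop atTop := by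

  have : Nonempty ι := Fintype.card_pos_iff.1 hι
  have : Countable Γ := countable_of_closure_range_eq_top hgen
  have hd : (0 : ℝ) < Fintype.card ι := by exact_mod_cast hι
  have hrate : 0 < returnRate s := one_pos.trans_le (one_le_returnRate h2)
  rw [spectralRadius_mkCayley] at hlam
  have hlam0 : 0 < lam := hlam ▸ div_pos hrate hd
  refine ⟨fun k hk invk hk1 hk2 hk3 => ?_, ?_⟩
  · have hk0 : k ≠ 0 := Nat.one_le_iff_ne_zero.1 hk
    have hcard : (Fintype.card (Fin k → ι) : ℝ) = Fintype.card ι ^ k := by simp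
    constructor
    · refine (spectralRadius_mkCayley _).trans ?_
      rw [returnRate_wordProd s hk0, hlam, div_pow, Nat.cast_pow]
    · rintro μ hμ δ rfl
      have hlt : returnRate (wordProd Γ ι s k) < Fintype.card (Fin k → ι) := by
        rw [returnRate_wordProd s hk0, hcard]
        exact pow_lt_pow_left₀ ((div_lt_one hd).1 (hlam ▸ hlam1)) hrate.le hk0
      refine le_trans (le_of_eq ?_) (le_integral_survivingDegree_mkCayley hμ hlt)
      rw [returnRate_wordProd s hk0, hcard, hlam, div_pow]
      field_simp
  · have h : Tendsto (fun k : ℕ => (1 / 4) * (lam⁻¹) ^ k) atTop atTop :=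
      (tendsto_pow_atTop_atTop_of_one_lt ((one_lt_inv₀ hlam0).2 hlam1)).const_mul_atTop
        (by norm_num)
    refine (tendsto_atTop_add_const_right atTop (-(1 / 4) : ℝ) h).congr fun k => ?_
    rw [inv_pow, one_div (4 * _), mul_inv]
    ring
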